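/- Assume k ≥ 2 and let f = R·e^P as in the setup, with arg a_k ∈ [0, 2π). Then Π_0(f) = { ζ ↦ f(C₁ + C₂ζ) : C₁ ∈ ℂ, C₂ a real number with C₂ > 0 } ∪ { ζ ↦ e^{A₁ζ + A₀} : A₀ ∈ ℂ, A₁ ≠ 0 with arg A₁ = (ε·(π/2)·(k−1) + arg a_k + (k−1)·2πl)/k (mod 2π) for some ε ∈ {+1, −1} and some l ∈ {0, 1, …, k−1} }. -/

import Mathlib

open Filter Topology Complex

noncomputable section

/-- Locally uniform convergence on `ℂ` with respect to the spherical metric,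
expressed via the Euclidean criterion: near every point, either the functions
converge uniformly to `g` in the Euclidean metric, or they are eventually
nonvanishing there and their reciprocals converge uniformly to `1/g`. -/
def SphLocUnifConv (F : ℕ → ℂ → ℂ) (g : ℂ → ℂ) : Prop :=
  ∀ z₀ : ℂ, ∃ U ∈ 𝓝 z₀,
    TendstoUniformlyOn F g atTop U ∨
    ((∀ᶠ n in atTop, ∀ w ∈ U, F n w ≠ 0) ∧
      TendstoUniformlyOn (fun n w => (F n w)⁻¹) (fun w => (g w)⁻¹) atTop U)

/-- `Π_α(h)` : the set of all nonconstant meromorphic functions `g` on `ℂ` for which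
there exist `z₀ ∈ ℂ`, naturals `k n → ∞`, complex `z n → z₀` and positive reals
`ρ n → 0` such that `ζ ↦ ρ n ^ (-α) * h (k n * z n + k n * ρ n * ζ)` converges to `g`
locally uniformly on `ℂ` in the spherical metric. -/
def PiAlpha (α : ℝ) (h : ℂ → ℂ) : Set (ℂ → ℂ) :=
  { g | MeromorphicOn g Set.univ ∧ (∀ c : ℂ, g ≠ fun _ => c) ∧
      ∃ (z₀ : ℂ) (k : ℕ → ℕ) (z : ℕ → ℂ) (ρ : ℕ → ℝ),
        Tendsto k atTop atTop ∧
        Tendsto z atTop (𝓝 z₀) ∧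
        (∀ n, 0 < ρ n) ∧ Tendsto ρ atTop (𝓝 0) ∧
        SphLocUnifConv
          (fun n ζ => ((ρ n ^ (-α) : ℝ) : ℂ) * h ((k n : ℂ) * z n + (k n : ℂ) * (ρ n : ℂ) * ζ))
          g }

/-- Pointwise content of spherical convergence along an arbitrary filter. -/
def SphPointwiseConv {ι : Type*} (F : ι → ℂ → ℂ) (l : Filter ι) (g : ℂ → ℂ) : Prop :=
  ∀ z₀ : ℂ, ∃ U ∈ 𝓝 z₀,
    (∀ w ∈ U, Tendsto (fun n => F n w) l (𝓝 (g w))) ∨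
    ((∀ᶠ n in l, ∀ w ∈ U, F n w ≠ 0) ∧
      ∀ w ∈ U, Tendsto (fun n => (F n w)⁻¹) l (𝓝 (g w)⁻¹))

lemma SphLocUnifConv.pointwise {F : ℕ → ℂ → ℂ} {g : ℂ → ℂ} (h : SphLocUnifConv F g)
    {l : Filter ℕ} (hl : l ≤ atTop) : SphPointwiseConv F l g := by
  intro z₀
  obtain ⟨U, hU, h | ⟨h1, h2⟩⟩ := h z₀
  · exact ⟨U, hU, Or.inl fun w hw => (h.tendsto_at hw).mono_left hl⟩
  · exact ⟨U, hU, Or.inr ⟨h1.filter_mono hl, fun w hw => (h2.tendsto_at hw).mono_left hl⟩⟩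

lemma SphPointwiseConv.congr' {ι : Type*} {F G : ι → ℂ → ℂ} {l : Filter ι} {g : ℂ → ℂ}
    (h : SphPointwiseConv F l g) (hFG : F =ᶠ[l] G) : SphPointwiseConv G l g := by
  intro z₀
  obtain ⟨U, hU, h | ⟨h1, h2⟩⟩ := h z₀
  · exact ⟨U, hU, Or.inl fun w hw => (h w hw).congr' (hFG.mono fun n hn => by rw [hn])⟩
  · refine ⟨U, hU, Or.inr ⟨?_, fun w hw => (h2 w hw).congr' (hFG.mono fun n hn => by rw [hn])⟩⟩
    filter_upwards [h1, hFG] with n hn hn'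
    rwa [← hn']

section Pointwise

variable {ι : Type*} {F : ι → ℂ → ℂ} {l : Filter ι} [l.NeBot] {g : ℂ → ℂ}

lemma not_tendsto_inv_of_tendsto_zero {u : ι → ℂ} {c : ℂ} (hu : Tendsto u l (𝓝 0))
    (hne : ∀ᶠ n in l, u n ≠ 0) : ¬ Tendsto (fun n => (u n)⁻¹) l (𝓝 c) := by
  intro h
  have h1 : Tendsto (fun n => u n * (u n)⁻¹) l (𝓝 (0 * c)) := hu.mul h
  have h2 : Tendsto (fun _ : ι => (1 : ℂ)) l (𝓝 (0 * c)) :=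
    h1.congr' (hne.mono fun n hn => mul_inv_cancel₀ hn)
  simpa using tendsto_nhds_unique h2 tendsto_const_nhds

lemma not_tendsto_of_norm_tendsto_atTop {u : ι → ℂ} {c : ℂ}
    (hu : Tendsto (fun n => ‖u n‖) l atTop) : ¬ Tendsto u l (𝓝 c) := fun h =>
  not_tendsto_atTop_of_tendsto_nhds h.norm hu

lemma SphPointwiseConv.eq_of_tendsto (h : SphPointwiseConv F l g) {ζ c : ℂ}
    (hc : Tendsto (fun n => F n ζ) l (𝓝 c)) : g ζ = c := by
  obtain ⟨U, hU, h | ⟨h1, h2⟩⟩ := h ζ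
  · exact tendsto_nhds_unique (h ζ (mem_of_mem_nhds hU)) hc
  · have hne : ∀ᶠ n in l, F n ζ ≠ 0 := h1.mono fun n hn => hn ζ (mem_of_mem_nhds hU)
    have h2 := h2 ζ (mem_of_mem_nhds hU)
    rcases eq_or_ne c 0 with rfl | hc0
    · exact absurd h2 (not_tendsto_inv_of_tendsto_zero hc hne)
    · exact inv_injective (tendsto_nhds_unique h2 (hc.inv₀ hc0))

lemma SphPointwiseConv.eq_zero_of_norm_tendsto_atTop (h : SphPointwiseConv F l g) {ζ : ℂ}
    (hc : Tendsto (fun n => ‖F n ζ‖) l atTop) : g ζ = 0 := by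
  obtain ⟨U, hU, h | ⟨-, h2⟩⟩ := h ζ
  · exact absurd (h ζ (mem_of_mem_nhds hU)) (not_tendsto_of_norm_tendsto_atTop hc)
  · have h0 : Tendsto (fun n => (F n ζ)⁻¹) l (𝓝 0) := by
      rw [tendsto_zero_iff_norm_tendsto_zero]
      simpa only [norm_inv, Function.comp_def] using tendsto_inv_atTop_zero.comp hc
    exact inv_eq_zero.mp (tendsto_nhds_unique (h2 ζ (mem_of_mem_nhds hU)) h0)

/-- The functions cannot tend to `0` and to `∞` at points arbitrarily close to one and the
same point. -/
lemma SphPointwiseConv.false_of_zero_of_infty (h : SphPointwiseConv F l g) (z₀ a b : ℂ)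
    (ha : ∀ t : ℝ, 0 < t → Tendsto (fun n => F n (z₀ + t * a)) l (𝓝 0))
    (hb : ∀ t : ℝ, 0 < t → Tendsto (fun n => ‖F n (z₀ + t * b)‖) l atTop) : False := by
  obtain ⟨U, hU, h⟩ := h z₀
  have key : ∀ e : ℂ, ∃ t : ℝ, 0 < t ∧ z₀ + t * e ∈ U := by
    intro e
    have hc : Tendsto (fun t : ℝ => z₀ + t * e) (𝓝 0) (𝓝 z₀) := by
      have : Continuous fun t : ℝ => z₀ + t * e := by fun_prop
      simpa using this.tendsto 0
    have h1 : ∀ᶠ t : ℝ in 𝓝[>] 0, z₀ + t * e ∈ U :=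
      (hc.eventually hU).filter_mono nhdsWithin_le_nhds
    obtain ⟨t, h1, h2⟩ := (h1.and self_mem_nhdsWithin).exists
    exact ⟨t, h2, h1⟩
  obtain ⟨s, hs, hsU⟩ := key a
  obtain ⟨t, ht, htU⟩ := key b
  obtain h | ⟨h1, h2⟩ := h
  · exact not_tendsto_of_norm_tendsto_atTop (hb t ht) (h _ htU)
  · exact not_tendsto_inv_of_tendsto_zero (ha s hs) (h1.mono fun n hn => hn _ hsU) (h2 _ hsU)

end Pointwise

lemma Ultrafilter.tendsto_nhds_or_norm_atTop {ι E : Type*} [NormedAddCommGroup E] [ProperSpace E]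
    (l : Ultrafilter ι) (u : ι → E) :
    (∃ c, Tendsto u l (𝓝 c)) ∨ Tendsto (fun n => ‖u n‖) l atTop := by
  by_cases h : ∃ M : ℝ, ∀ᶠ n in l, ‖u n‖ ≤ M
  · left
    obtain ⟨M, hM⟩ := h
    have : (l.map u : Filter E) ≤ 𝓟 (Metric.closedBall 0 M) := by
      rw [Filter.le_principal_iff]
      exact hM.mono fun n hn => by simpa using hn
    obtain ⟨c, -, hc⟩ := (isCompact_closedBall (0 : E) M).ultrafilter_le_nhds (l.map u) this
    exact ⟨c, hc⟩
  · right
    rw [tendsto_atTop]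
    intro M
    by_contra hM
    refine h ⟨M, ?_⟩
    rw [← Ultrafilter.eventually_not] at hM
    exact hM.mono fun n hn => (not_le.mp hn).le

section Growth

variable {ι : Type*} {l : Filter ι}

lemma tendsto_pow_div_pow_of_norm_atTop {w : ι → ℂ} (hw : Tendsto (fun n => ‖w n‖) l atTop)
    {j k : ℕ} (hjk : j < k) : Tendsto (fun n => w n ^ j / w n ^ k) l (𝓝 0) := by
  have h0 : ∀ᶠ n in l, w n ≠ 0 := (hw.eventually_gt_atTop 0).mono fun n hn => norm_pos_iff.mp hn
  have h1 : Tendsto (fun n => (w n ^ (k - j))⁻¹) l (𝓝 0) := by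
    rw [tendsto_zero_iff_norm_tendsto_zero]
    simpa only [norm_inv, norm_pow, Function.comp_def] using tendsto_inv_atTop_zero.comp
      ((tendsto_pow_atTop (Nat.sub_ne_zero_of_lt hjk)).comp hw)
  refine h1.congr' (h0.mono fun n hn => ?_)
  obtain ⟨i, rfl⟩ := Nat.exists_eq_add_of_lt hjk
  beta_reduce
  rw [show j + i + 1 - j = i + 1 by omega, add_assoc, pow_add (w n) j]
  field_simp

lemma tendsto_eval_div_pow {w : ι → ℂ} (hw : Tendsto (fun n => ‖w n‖) l atTop)
    (P : Polynomial ℂ) :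
    Tendsto (fun n => P.eval (w n) / w n ^ P.natDegree) l (𝓝 P.leadingCoeff) := by
  have h0 : ∀ᶠ n in l, w n ≠ 0 := (hw.eventually_gt_atTop 0).mono fun n hn => norm_pos_iff.mp hn
  have h1 : Tendsto (fun n => ∑ j ∈ Finset.range P.natDegree,
      P.coeff j * (w n ^ j / w n ^ P.natDegree) + P.leadingCoeff) l
      (𝓝 (∑ j ∈ Finset.range P.natDegree, P.coeff j * 0 + P.leadingCoeff)) :=
    (tendsto_finsetSum _ fun j hj =>
      (tendsto_pow_div_pow_of_norm_atTop hw (Finset.mem_range.mp hj)).const_mul _).add_const _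
  simp only [mul_zero, Finset.sum_const_zero, zero_add] at h1
  refine h1.congr' (h0.mono fun n hn => ?_)
  beta_reduce
  rw [Polynomial.eval_eq_sum_range, Finset.sum_range_succ, add_div, Finset.sum_div,
    mul_div_assoc, div_self (pow_ne_zero _ hn), mul_one]
  simp only [mul_div_assoc, Polynomial.leadingCoeff]

/-- First-order expansion of a polynomial at a point escaping to infinity, on a scale small
compared with that point. -/
lemma tendsto_eval_sub_eval_div {w r ζ : ι → ℂ} {z : ℂ}
    (hw : Tendsto (fun n => ‖w n‖) l atTop) (hr : ∀ n, r n ≠ 0)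
    (hrw : Tendsto (fun n => r n / w n) l (𝓝 0)) (hζ : Tendsto ζ l (𝓝 z))
    (P : Polynomial ℂ) (hP : 1 ≤ P.natDegree) :
    Tendsto (fun n => (P.eval (w n + r n * ζ n) - P.eval (w n)) / (w n ^ (P.natDegree - 1) * r n))
      l (𝓝 (P.natDegree * P.leadingCoeff * z)) := by
  have h0 : ∀ᶠ n in l, w n ≠ 0 := (hw.eventually_gt_atTop 0).mono fun n hn => norm_pos_iff.mp hn
  set k := P.natDegree with hk
  have hG : ∀ j : ℕ, Tendsto (fun n => (∑ i ∈ Finset.range j, (1 + r n / w n * ζ n) ^ i) * ζ n) l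
      (𝓝 (j * z)) := by
    intro j
    have h1 : Tendsto (fun n => 1 + r n / w n * ζ n) l (𝓝 1) := by
      simpa using (hrw.mul hζ).const_add 1
    have h2 := (tendsto_finsetSum (Finset.range j) fun i _ => h1.pow i).mul hζ
    simpa using h2
  have h1 : Tendsto (fun n => ∑ j ∈ Finset.range k, P.coeff j * ((w n ^ j / w n ^ k) *
        ((∑ i ∈ Finset.range j, (1 + r n / w n * ζ n) ^ i) * ζ n)) +
        P.leadingCoeff * ((∑ i ∈ Finset.range k, (1 + r n / w n * ζ n) ^ i) * ζ n)) l
      (𝓝 (∑ j ∈ Finset.range k, P.coeff j * (0 * (j * z)) + P.leadingCoeff * (k * z))) :=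
    (tendsto_finsetSum _ fun j hj =>
      ((tendsto_pow_div_pow_of_norm_atTop hw (Finset.mem_range.mp hj)).mul (hG j)).const_mul _).add
      ((hG k).const_mul _)
  have h2 : ∑ j ∈ Finset.range k, P.coeff j * (0 * (j * z)) + P.leadingCoeff * (k * z)
      = k * P.leadingCoeff * z := by simp; ring
  rw [h2] at h1
  refine h1.congr' (h0.mono fun n hn => ?_)
  have hD : ∀ j : ℕ, (w n + r n * ζ n) ^ j - w n ^ j =
      w n ^ j * (r n / w n) * ((∑ i ∈ Finset.range j, (1 + r n / w n * ζ n) ^ i) * ζ n) := by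
    intro j
    have e1 : w n + r n * ζ n = w n * (1 + r n / w n * ζ n) := by field_simp
    have e2 := geom_sum_mul (1 + r n / w n * ζ n) j
    rw [e1, mul_pow]
    linear_combination (-w n ^ j) * e2
  have hden : w n ^ (k - 1) * r n = w n ^ k * (r n / w n) := by
    obtain ⟨k', hk'⟩ : ∃ k', k = k' + 1 := ⟨k - 1, by omega⟩
    rw [hk', Nat.add_sub_cancel, pow_succ]; field_simp
  beta_reduce
  rw [hden, Polynomial.eval_eq_sum_range, Polynomial.eval_eq_sum_range, ← Finset.sum_sub_distrib,
    ← hk, Finset.sum_range_succ, add_div, Finset.sum_div]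
  have hrn := hr n
  congr 1
  · refine Finset.sum_congr rfl fun j _ => ?_
    rw [← mul_sub, hD]
    field_simp
  · rw [← mul_sub, hD, Polynomial.leadingCoeff, ← hk]
    field_simp

end Growth
/-- A function with the local and asymptotic behaviour of a quotient of monic polynomials of
degree difference `d` that takes the value `0` at its poles. -/
structure IsMonicRational (R : ℂ → ℂ) (d : ℤ) : Prop where
  tendsto_div_zpow : Tendsto (fun x => R x / x ^ d) (Bornology.cobounded ℂ) (𝓝 1)
  continuousAt_or_pole : ∀ x, ContinuousAt R x ∨
    (R x = 0 ∧ Tendsto (fun y => ‖R y‖) (𝓝[≠] x) atTop)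

section Rational

variable {ι : Type*} {l : Filter ι} {R : ℂ → ℂ} {d : ℤ}

lemma IsMonicRational.tendsto (hR : IsMonicRational R d) {x : ι → ℂ}
    (hx : Tendsto (fun n => ‖x n‖) l atTop) :
    Tendsto (fun n => R (x n) / x n ^ d) l (𝓝 1) :=
  hR.tendsto_div_zpow.comp (tendsto_norm_atTop_iff_cobounded.mp hx)

lemma IsMonicRational.eventually_ne_zero (hR : IsMonicRational R d) {x : ι → ℂ}
    (hx : Tendsto (fun n => ‖x n‖) l atTop) : ∀ᶠ n in l, R (x n) ≠ 0 := by
  filter_upwards [(hR.tendsto hx).eventually_ne one_ne_zero] with n hn h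
  simp [h] at hn

lemma IsMonicRational.tendsto_log_div (hR : IsMonicRational R d) {x : ι → ℂ}
    (hx : Tendsto (fun n => ‖x n‖) l atTop) {k : ℕ} (hk : 1 ≤ k) :
    Tendsto (fun n => Real.log ‖R (x n)‖ / ‖x n‖ ^ k) l (𝓝 0) := by
  have hpow : Tendsto (fun n => ‖x n‖ ^ k) l atTop :=
    (tendsto_pow_atTop (by omega)).comp hx
  have h1 : Tendsto (fun n => Real.log ‖x n‖ / ‖x n‖ ^ k) l (𝓝 0) := by
    have := (Real.isLittleO_log_id_atTop.trans_isBigO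
      (f := Real.log) (k := fun t : ℝ => t ^ k) ?_).tendsto_div_nhds_zero
    · exact this.comp hx
    · refine Asymptotics.IsBigO.of_bound 1 ?_
      filter_upwards [eventually_ge_atTop (1 : ℝ)] with t ht
      rw [one_mul, id, Real.norm_of_nonneg (by positivity), Real.norm_of_nonneg (by positivity)]
      exact le_self_pow₀ ht (by omega)
  have h2 : Tendsto (fun n => Real.log ‖R (x n) / x n ^ d‖) l (𝓝 0) := by
    simpa using (hR.tendsto hx).norm.log (by simp)
  have h3 := (h1.const_mul (d : ℝ)).add (h2.div_atTop hpow)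
  simp only [mul_zero, add_zero] at h3
  refine h3.congr' ?_
  filter_upwards [hx.eventually_gt_atTop 0, hR.eventually_ne_zero hx] with n hn hRn
  have hz : ‖x n‖ ^ d ≠ 0 := zpow_ne_zero _ hn.ne'
  rw [norm_div, norm_zpow, Real.log_div (norm_ne_zero_iff.mpr hRn) hz, Real.log_zpow]
  ring

lemma tendsto_add_mul_div {w r ζ : ι → ℂ} {z : ℂ} (hw : Tendsto (fun n => ‖w n‖) l atTop)
    (hrw : Tendsto (fun n => r n / w n) l (𝓝 0)) (hζ : Tendsto ζ l (𝓝 z)) :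
    Tendsto (fun n => (w n + r n * ζ n) / w n) l (𝓝 1) := by
  have h1 : Tendsto (fun n => 1 + r n / w n * ζ n) l (𝓝 1) := by
    simpa using (hrw.mul hζ).const_add 1
  refine h1.congr' ?_
  filter_upwards [hw.eventually_gt_atTop 0] with n hn
  have : w n ≠ 0 := norm_pos_iff.mp hn
  field_simp

lemma tendsto_norm_of_div_tendsto_one {x w : ι → ℂ} (hw : Tendsto (fun n => ‖w n‖) l atTop)
    (hxw : Tendsto (fun n => x n / w n) l (𝓝 1)) : Tendsto (fun n => ‖x n‖) l atTop := by
  have h1 : Tendsto (fun n => ‖w n‖ * ‖x n / w n‖) l atTop :=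
    hw.atTop_mul_pos (by simp : (0 : ℝ) < ‖(1 : ℂ)‖) hxw.norm
  refine h1.congr' ?_
  filter_upwards [hw.eventually_gt_atTop 0] with n hn
  rw [norm_div]; field_simp

lemma IsMonicRational.tendsto_ratio (hR : IsMonicRational R d) {x w : ι → ℂ}
    (hw : Tendsto (fun n => ‖w n‖) l atTop) (hxw : Tendsto (fun n => x n / w n) l (𝓝 1)) :
    Tendsto (fun n => R (x n) / w n ^ d) l (𝓝 1) := by
  have hx := tendsto_norm_of_div_tendsto_one hw hxw
  have h1 := (hR.tendsto hx).mul (hxw.zpow₀ d (Or.inl one_ne_zero))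
  simp only [one_zpow, mul_one] at h1
  refine h1.congr' ?_
  filter_upwards [hx.eventually_gt_atTop 0] with n hn
  have : x n ^ d ≠ 0 := zpow_ne_zero _ (norm_pos_iff.mp hn)
  rw [div_zpow]
  field_simp

variable {P : Polynomial ℂ}

lemma log_norm_mul_exp {a b : ℂ} (ha : a ≠ 0) :
    Real.log ‖a * exp b‖ = Real.log ‖a‖ + b.re := by
  rw [norm_mul, Complex.norm_exp, Real.log_mul (norm_ne_zero_iff.mpr ha) (Real.exp_ne_zero _),
    Real.log_exp]

/-- Growth of `R * exp P` along a sequence escaping to infinity in a given direction. -/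
lemma IsMonicRational.tendsto_log_mul_exp_div (hR : IsMonicRational R d) (hP : 1 ≤ P.natDegree)
    {x : ι → ℂ} {e : ℂ} (hx : Tendsto (fun n => ‖x n‖) l atTop)
    (he : Tendsto (fun n => x n / ‖x n‖) l (𝓝 e)) :
    Tendsto (fun n => Real.log ‖R (x n) * exp (P.eval (x n))‖ / ‖x n‖ ^ P.natDegree) l
      (𝓝 (P.leadingCoeff * e ^ P.natDegree).re) := by
  have h1 := (tendsto_eval_div_pow hx P).mul (he.pow P.natDegree)
  have h2 := (hR.tendsto_log_div hx hP).add ((Complex.continuous_re.tendsto _).comp h1)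
  rw [zero_add] at h2
  refine h2.congr' ?_
  filter_upwards [hx.eventually_gt_atTop 0, hR.eventually_ne_zero hx] with n hn hRn
  have hx0 : x n ≠ 0 := norm_pos_iff.mp hn
  rw [log_norm_mul_exp hRn, add_div, Function.comp_apply]
  congr 1
  have : P.eval (x n) / x n ^ P.natDegree * (x n / ‖x n‖) ^ P.natDegree
      = P.eval (x n) / ((‖x n‖ ^ P.natDegree : ℝ) : ℂ) := by
    rw [div_pow]; push_cast
    have : x n ^ P.natDegree ≠ 0 := pow_ne_zero _ hx0
    field_simp
  rw [this, Complex.div_ofReal_re]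

lemma norm_tendsto_atTop_of_log {y : ι → ℂ} (h : Tendsto (fun n => Real.log ‖y n‖) l atTop) :
    Tendsto (fun n => ‖y n‖) l atTop :=
  tendsto_atTop_mono (fun _ => Real.log_le_self (norm_nonneg _)) h

lemma tendsto_zero_of_log {y : ι → ℂ} (h : Tendsto (fun n => Real.log ‖y n‖) l atBot) :
    Tendsto y l (𝓝 0) := by
  rw [tendsto_zero_iff_norm_tendsto_zero]
  exact squeeze_zero (fun _ => norm_nonneg _) (fun _ => Real.le_exp_log _)
    (Real.tendsto_exp_atBot.comp h)

lemma tendsto_atTop_of_div {u T : ι → ℝ} {c : ℝ} (hT : Tendsto T l atTop) (hc : 0 < c)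
    (h : Tendsto (fun n => u n / T n) l (𝓝 c)) : Tendsto u l atTop := by
  refine (hT.atTop_mul_pos hc h).congr' ?_
  filter_upwards [hT.eventually_gt_atTop 0] with n hn
  field_simp

lemma tendsto_atBot_of_div {u T : ι → ℝ} {c : ℝ} (hT : Tendsto T l atTop) (hc : c < 0)
    (h : Tendsto (fun n => u n / T n) l (𝓝 c)) : Tendsto u l atBot := by
  refine (hT.atTop_mul_neg hc h).congr' ?_
  filter_upwards [hT.eventually_gt_atTop 0] with n hn
  field_simp

lemma IsMonicRational.norm_tendsto_atTop (hR : IsMonicRational R d) (hP : 1 ≤ P.natDegree)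
    {x : ι → ℂ} {e : ℂ} (hx : Tendsto (fun n => ‖x n‖) l atTop)
    (he : Tendsto (fun n => x n / ‖x n‖) l (𝓝 e))
    (hre : 0 < (P.leadingCoeff * e ^ P.natDegree).re) :
    Tendsto (fun n => ‖R (x n) * exp (P.eval (x n))‖) l atTop :=
  norm_tendsto_atTop_of_log (tendsto_atTop_of_div
    ((tendsto_pow_atTop (by omega)).comp hx) hre (hR.tendsto_log_mul_exp_div hP hx he))

lemma IsMonicRational.tendsto_zero (hR : IsMonicRational R d) (hP : 1 ≤ P.natDegree)
    {x : ι → ℂ} {e : ℂ} (hx : Tendsto (fun n => ‖x n‖) l atTop)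
    (he : Tendsto (fun n => x n / ‖x n‖) l (𝓝 e))
    (hre : (P.leadingCoeff * e ^ P.natDegree).re < 0) :
    Tendsto (fun n => R (x n) * exp (P.eval (x n))) l (𝓝 0) :=
  tendsto_zero_of_log (tendsto_atBot_of_div
    ((tendsto_pow_atTop (by omega)).comp hx) hre (hR.tendsto_log_mul_exp_div hP hx he))

section Rescaling

variable {w r ζ : ι → ℂ} {z : ℂ}

lemma IsMonicRational.tendsto_shift_ratio (hR : IsMonicRational R d)
    (hw : Tendsto (fun n => ‖w n‖) l atTop)
    (hrw : Tendsto (fun n => r n / w n) l (𝓝 0)) (hζ : Tendsto ζ l (𝓝 z)) :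
    Tendsto (fun n => R (w n + r n * ζ n) / R (w n)) l (𝓝 1) := by
  have h1 := (hR.tendsto_ratio hw (tendsto_add_mul_div hw hrw hζ)).div (hR.tendsto hw) one_ne_zero
  rw [div_one] at h1
  refine h1.congr' ?_
  filter_upwards [hw.eventually_gt_atTop 0, hR.eventually_ne_zero hw] with n hn hRn
  have : w n ^ d ≠ 0 := zpow_ne_zero _ (norm_pos_iff.mp hn)
  simp only [Pi.div_apply]
  field_simp

/-- On the scale where `P` varies by a bounded amount, `R * exp P` looks like an exponential. -/
lemma IsMonicRational.tendsto_rescale (hR : IsMonicRational R d) (hP : 1 ≤ P.natDegree)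
    (hw : Tendsto (fun n => ‖w n‖) l atTop) (hr : ∀ n, r n ≠ 0)
    (hrw : Tendsto (fun n => r n / w n) l (𝓝 0)) (hζ : Tendsto ζ l (𝓝 z)) {b : ℂ}
    (hb : Tendsto (fun n => w n ^ (P.natDegree - 1) * r n) l (𝓝 b)) :
    Tendsto (fun n => R (w n + r n * ζ n) * exp (P.eval (w n + r n * ζ n)) /
      (R (w n) * exp (P.eval (w n)))) l (𝓝 (exp (b * (P.natDegree * P.leadingCoeff * z)))) := by
  have h1 := hb.mul (tendsto_eval_sub_eval_div hw hr hrw hζ P hP)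
  have h2 := (hR.tendsto_shift_ratio hw hrw hζ).mul ((Complex.continuous_exp.tendsto _).comp h1)
  rw [one_mul] at h2
  refine h2.congr' ?_
  filter_upwards [hw.eventually_gt_atTop 0] with n hn
  have h3 : w n ^ (P.natDegree - 1) * r n ≠ 0 :=
    mul_ne_zero (pow_ne_zero _ (norm_pos_iff.mp hn)) (hr n)
  rw [Function.comp_apply, mul_div_cancel₀ _ h3, Complex.exp_sub, mul_div_mul_comm]

lemma IsMonicRational.tendsto_log_rescale (hR : IsMonicRational R d) (hP : 1 ≤ P.natDegree)
    (hw : Tendsto (fun n => ‖w n‖) l atTop) (hr : ∀ n, r n ≠ 0)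
    (hrw : Tendsto (fun n => r n / w n) l (𝓝 0)) (hζ : Tendsto ζ l (𝓝 z)) {b : ι → ℂ} {u : ℂ}
    (hb : ∀ n, b n = w n ^ (P.natDegree - 1) * r n) (hbinf : Tendsto (fun n => ‖b n‖) l atTop)
    (hu : Tendsto (fun n => b n / ‖b n‖) l (𝓝 u)) :
    Tendsto (fun n => Real.log ‖R (w n + r n * ζ n) * exp (P.eval (w n + r n * ζ n))‖ / ‖b n‖ -
      Real.log ‖R (w n) * exp (P.eval (w n))‖ / ‖b n‖) l
      (𝓝 (u * (P.natDegree * P.leadingCoeff * z)).re) := by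
  have h1 := hu.mul (tendsto_eval_sub_eval_div hw hr hrw hζ P hP)
  have hlog : Tendsto (fun n => Real.log ‖R (w n + r n * ζ n) / R (w n)‖) l (𝓝 0) := by
    simpa using (hR.tendsto_shift_ratio hw hrw hζ).norm.log (by simp)
  have h2 := (hlog.div_atTop hbinf).add ((Complex.continuous_re.tendsto _).comp h1)
  rw [zero_add] at h2
  have hx := tendsto_norm_of_div_tendsto_one hw (tendsto_add_mul_div hw hrw hζ)
  refine h2.congr' ?_
  filter_upwards [hR.eventually_ne_zero hw, hR.eventually_ne_zero hx,
    hbinf.eventually_gt_atTop 0] with n h3 h4 h5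
  have hb0 : b n ≠ 0 := norm_pos_iff.mp h5
  have e : b n / ‖b n‖ * ((P.eval (w n + r n * ζ n) - P.eval (w n)) /
      (w n ^ (P.natDegree - 1) * r n)) =
      (P.eval (w n + r n * ζ n) - P.eval (w n)) / (‖b n‖ : ℂ) := by
    rw [← hb n]; field_simp
  rw [Function.comp_apply, e, Complex.div_ofReal_re, log_norm_mul_exp h3, log_norm_mul_exp h4,
    norm_div, Real.log_div (norm_ne_zero_iff.mpr h4) (norm_ne_zero_iff.mpr h3), Complex.sub_re]
  ring

end Rescaling

end Rational
section Limits

variable {ι : Type*} {R : ℂ → ℂ} {d : ℤ} {P : Polynomial ℂ} {g : ℂ → ℂ}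

lemma Ultrafilter.exists_tendsto_div_norm (l : Ultrafilter ι) {x : ι → ℂ}
    (hx : Tendsto (fun n => ‖x n‖) l atTop) :
    ∃ e : ℂ, ‖e‖ = 1 ∧ Tendsto (fun n => x n / ‖x n‖) l (𝓝 e) := by
  have h1 : ∀ᶠ n in (l : Filter ι), ‖x n / ‖x n‖‖ = 1 := by
    filter_upwards [hx.eventually_gt_atTop 0] with n hn
    simp [hn.ne']
  rcases l.tendsto_nhds_or_norm_atTop fun n => x n / (‖x n‖ : ℂ) with ⟨e, he⟩ | h
  · exact ⟨e, tendsto_nhds_unique he.norm (tendsto_const_nhds.congr' (h1.mono fun _ h => h.symm)),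
      he⟩
  · obtain ⟨n, hn, hn'⟩ := (h1.and (h.eventually_gt_atTop 1)).exists
    exact absurd hn hn'.ne'

lemma SphPointwiseConv.eq_of_argument_tendsto {l : Ultrafilter ι} {x : ι → ℂ → ℂ}
    (hR : IsMonicRational R d)
    (hg : SphPointwiseConv (fun n ζ => R (x n ζ) * exp (P.eval (x n ζ))) l g) {ζ y : ℂ}
    (hx : Tendsto (fun n => x n ζ) l (𝓝 y)) : g ζ = R y * exp (P.eval y) := by
  have hE : ContinuousAt (fun y => exp (P.eval y)) y := by fun_prop
  rcases hR.continuousAt_or_pole y with h | ⟨h0, h⟩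
  · exact hg.eq_of_tendsto ((h.mul hE).tendsto.comp hx)
  · rw [h0, zero_mul]
    by_cases hxy : ∀ᶠ n in (l : Filter ι), x n ζ = y
    · refine hg.eq_of_tendsto (tendsto_const_nhds.congr' (hxy.mono fun n hn => ?_))
      simp [hn, h0]
    · have hxy' : ∀ᶠ n in (l : Filter ι), x n ζ ≠ y := Ultrafilter.eventually_not.mpr hxy
      have h1 : Tendsto (fun n => x n ζ) l (𝓝[≠] y) :=
        tendsto_nhdsWithin_iff.mpr ⟨hx, hxy'⟩
      refine hg.eq_zero_of_norm_tendsto_atTop ?_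
      have h2 := (h.comp h1).atTop_mul_pos (norm_pos_iff.mpr (exp_ne_zero _))
        (hE.tendsto.comp hx).norm
      simpa [Function.comp_def] using h2

lemma exists_direction (hP : 1 ≤ P.natDegree) {c : ℝ} (hc : c ≠ 0) : ∃ u : ℂ, u ≠ 0 ∧
    (P.leadingCoeff * (u / ‖u‖) ^ P.natDegree).re = c / ‖u‖ ^ P.natDegree := by
  have ha : P.leadingCoeff ≠ 0 := by
    rw [Polynomial.leadingCoeff_ne_zero]; rintro rfl; simp at hP
  have hk : 0 < P.natDegree := hP
  obtain ⟨u, hu⟩ := IsAlgClosed.exists_pow_nat_eq ((c : ℂ) / P.leadingCoeff) hk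
  refine ⟨u, ?_, ?_⟩
  · rintro rfl
    rw [zero_pow hk.ne'] at hu
    exact div_ne_zero (by exact_mod_cast hc) ha hu.symm
  · rw [div_pow, hu]
    have : P.leadingCoeff * (c / P.leadingCoeff / (‖u‖ : ℂ) ^ P.natDegree) =
        ((c / ‖u‖ ^ P.natDegree : ℝ) : ℂ) := by
      push_cast; field_simp
    rw [this, Complex.ofReal_re]

variable {l : Ultrafilter ι} {w : ι → ℂ} {r : ι → ℝ}

/-- When the scale tends to infinity and dominates the centre, there is no limit. -/
lemma SphPointwiseConv.false_of_large_scale (hR : IsMonicRational R d) (hP : 1 ≤ P.natDegree)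
    (hg : SphPointwiseConv
      (fun n ζ => R (w n + r n * ζ) * exp (P.eval (w n + r n * ζ))) l g)
    (hr : Tendsto r l atTop) {q : ℂ} (hq : Tendsto (fun n => w n / r n) l (𝓝 q)) : False := by
  have key : ∀ u : ℂ, u ≠ 0 → ∀ t : ℝ, 0 < t →
      Tendsto (fun n => ‖w n + r n * (-q + t * u)‖) l atTop ∧
      Tendsto (fun n => (w n + r n * (-q + t * u)) / ‖w n + r n * (-q + t * u)‖) l
        (𝓝 (u / ‖u‖)) := by
    intro u hu t ht
    have htu : (t : ℂ) * u ≠ 0 := mul_ne_zero (by exact_mod_cast ht.ne') hu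
    have h1 : Tendsto (fun n => w n / r n + (-q + t * u)) l (𝓝 (t * u)) := by
      simpa using hq.add_const (-q + t * u)
    have e : ∀ᶠ n in (l : Filter ι), 0 < r n ∧
        w n + r n * (-q + t * u) = r n * (w n / r n + (-q + t * u)) := by
      filter_upwards [hr.eventually_gt_atTop 0] with n hn
      have : (r n : ℂ) ≠ 0 := by exact_mod_cast hn.ne'
      refine ⟨hn, by field_simp⟩
    constructor
    · refine (hr.atTop_mul_pos (norm_pos_iff.mpr htu) h1.norm).congr' (e.mono fun n hn => ?_)
      beta_reduce
      rw [hn.2, norm_mul, Complex.norm_real, Real.norm_of_nonneg hn.1.le]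
    · have h2 := h1.div (Complex.continuous_ofReal.continuousAt.tendsto.comp h1.norm)
        (by simpa using htu)
      have e2 : (t * u : ℂ) / (‖(t * u : ℂ)‖ : ℂ) = u / ‖u‖ := by
        have : (t : ℂ) ≠ 0 := by exact_mod_cast ht.ne'
        rw [norm_mul, Complex.norm_real, Real.norm_of_nonneg ht.le]
        push_cast
        rw [mul_div_mul_left _ _ this]
      rw [e2] at h2
      refine h2.congr' (e.mono fun n hn => ?_)
      have : (r n : ℂ) ≠ 0 := by exact_mod_cast hn.1.ne'
      simp only [Pi.div_apply, Function.comp_apply]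
      rw [hn.2, norm_mul, Complex.norm_real, Real.norm_of_nonneg hn.1.le]
      push_cast
      rw [mul_div_mul_left _ _ this]
  obtain ⟨u, hu0, hu⟩ := exists_direction hP one_ne_zero
  obtain ⟨v, hv0, hv⟩ := exists_direction hP (neg_ne_zero.mpr one_ne_zero)
  refine hg.false_of_zero_of_infty (-q) v u (fun t ht => ?_) (fun t ht => ?_)
  · obtain ⟨h1, h2⟩ := key v hv0 t ht
    refine hR.tendsto_zero hP h1 h2 ?_
    rw [hv]
    exact div_neg_of_neg_of_pos (by norm_num) (by positivity)
  · obtain ⟨h1, h2⟩ := key u hu0 t ht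
    refine hR.norm_tendsto_atTop hP h1 h2 ?_
    rw [hu]
    positivity

/-- When `P` varies by an unbounded amount on a scale small compared with the centre, every limit
is identically zero. -/
lemma SphPointwiseConv.eq_zero_of_unbounded_variation (hR : IsMonicRational R d)
    (hP : 1 ≤ P.natDegree)
    (hg : SphPointwiseConv
      (fun n ζ => R (w n + r n * ζ) * exp (P.eval (w n + r n * ζ))) l g)
    (hr : ∀ n, 0 < r n) (hw : Tendsto (fun n => ‖w n‖) l atTop)
    (hrw : Tendsto (fun n => (r n : ℂ) / w n) l (𝓝 0))
    (hb : Tendsto (fun n => ‖w n ^ (P.natDegree - 1) * r n‖) l atTop) (ζ : ℂ) : g ζ = 0 := by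
  have ha : P.leadingCoeff ≠ 0 := by
    rw [Polynomial.leadingCoeff_ne_zero]; rintro rfl; simp at hP
  have hr0 : ∀ n, (r n : ℂ) ≠ 0 := fun n => by exact_mod_cast (hr n).ne'
  obtain ⟨u, hu1, hu⟩ := l.exists_tendsto_div_norm hb
  have hlog : ∀ ζ : ℂ, _ := fun ζ =>
    hR.tendsto_log_rescale hP hw hr0 hrw (tendsto_const_nhds (x := ζ)) (fun _ => rfl) hb hu
  set B := fun n => ‖w n ^ (P.natDegree - 1) * r n‖ with hB
  set L := fun n => Real.log ‖R (w n) * exp (P.eval (w n))‖ / B n with hL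
  have hsum : ∀ ζ n, L n + (Real.log ‖R (w n + r n * ζ) * exp (P.eval (w n + r n * ζ))‖ / B n
      - L n) = Real.log ‖R (w n + r n * ζ) * exp (P.eval (w n + r n * ζ))‖ / B n := by
    intro ζ n; ring
  have hmul : ∀ y n, 0 < B n → y / B n * B n = y := fun y n hn => div_mul_cancel₀ _ hn.ne'
  rcases l.tendsto_nhds_or_norm_atTop L with ⟨c, hc⟩ | hinf
  · exfalso
    have hlim : ∀ ζ, Tendsto (fun n => Real.log
        ‖R (w n + r n * ζ) * exp (P.eval (w n + r n * ζ))‖ / B n) l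
        (𝓝 (c + (u * (P.natDegree * P.leadingCoeff * ζ)).re)) := fun ζ =>
      (hc.add (hlog ζ)).congr (hsum ζ)
    have hu0 : u ≠ 0 := by rintro rfl; simp at hu1
    have hk0 : (P.natDegree : ℂ) ≠ 0 := by exact_mod_cast (by omega : P.natDegree ≠ 0)
    set D := u * (P.natDegree * P.leadingCoeff) with hD
    have hD0 : D ≠ 0 := mul_ne_zero hu0 (mul_ne_zero hk0 ha)
    have hval : ∀ s t : ℝ, (u * (P.natDegree * P.leadingCoeff * (-c / D + t * (s / D)))).re
        = -c + t * s := by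
      intro s t
      have : u * (P.natDegree * P.leadingCoeff * (-c / D + t * (s / D))) =
          ((-c + t * s : ℝ) : ℂ) := by
        rw [← mul_assoc u, ← hD]; push_cast; field_simp
      rw [this, Complex.ofReal_re]
    refine hg.false_of_zero_of_infty (-c / D) ((-1 : ℝ) / D) ((1 : ℝ) / D)
      (fun t ht => ?_) (fun t ht => ?_)
    · refine tendsto_zero_of_log (tendsto_atBot_of_div hb ?_ (hlim _))
      rw [hval]; linarith
    · refine norm_tendsto_atTop_of_log (tendsto_atTop_of_div hb ?_ (hlim _))
      rw [hval]; linarith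
  · by_cases hpos : ∀ᶠ n in (l : Filter ι), 0 ≤ L n
    · have hLt : Tendsto L l atTop :=
        hinf.congr' (hpos.mono fun n hn => Real.norm_of_nonneg hn)
      refine hg.eq_zero_of_norm_tendsto_atTop (norm_tendsto_atTop_of_log ?_)
      have h1 := (hLt.atTop_add (hlog ζ)).atTop_mul_atTop₀ hb
      refine h1.congr' ?_
      filter_upwards [hb.eventually_gt_atTop 0] with n hn
      rw [hsum, hmul _ _ hn]
    · have hneg : ∀ᶠ n in (l : Filter ι), ¬ 0 ≤ L n := Ultrafilter.eventually_not.mpr hpos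
      have hLt : Tendsto L l atBot := by
        refine (tendsto_neg_atTop_atBot.comp hinf).congr' (hneg.mono fun n hn => ?_)
        simp [abs_of_neg (not_le.mp hn)]
      refine hg.eq_of_tendsto (tendsto_zero_of_log ?_)
      have h1 := (hLt.atBot_add (hlog ζ)).atBot_mul_atTop₀ hb
      refine h1.congr' ?_
      filter_upwards [hb.eventually_gt_atTop 0] with n hn
      rw [hsum, hmul _ _ hn]

lemma SphPointwiseConv.exponential_of_bounded_variation (hR : IsMonicRational R d)
    (hP : 1 ≤ P.natDegree)
    (hg : SphPointwiseConv
      (fun n ζ => R (w n + r n * ζ) * exp (P.eval (w n + r n * ζ))) l g)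
    (hne : ∀ c : ℂ, g ≠ fun _ => c)
    (hr : ∀ n, 0 < r n) (hw : Tendsto (fun n => ‖w n‖) l atTop)
    (hrw : Tendsto (fun n => (r n : ℂ) / w n) l (𝓝 0)) {b : ℂ}
    (hb : Tendsto (fun n => w n ^ (P.natDegree - 1) * r n) l (𝓝 b)) :
    ∃ (e A₀ : ℂ) (t : ℝ), ‖e‖ = 1 ∧ (P.leadingCoeff * e ^ P.natDegree).re = 0 ∧ 0 < t ∧
      g = fun ζ => exp (t * (P.leadingCoeff * e ^ (P.natDegree - 1)) * ζ + A₀) := by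
  have hr0 : ∀ n, (r n : ℂ) ≠ 0 := fun n => by exact_mod_cast (hr n).ne'
  have hratio : ∀ ζ : ℂ, _ := fun ζ =>
    hR.tendsto_rescale hP hw hr0 hrw (tendsto_const_nhds (x := ζ)) hb
  have hc0 : ∀ᶠ n in (l : Filter ι), R (w n) * exp (P.eval (w n)) ≠ 0 :=
    (hR.eventually_ne_zero hw).mono fun n hn => mul_ne_zero hn (exp_ne_zero _)
  rcases l.tendsto_nhds_or_norm_atTop fun n => R (w n) * exp (P.eval (w n)) with ⟨c, hc⟩ | hinf
  · have hgc : g = fun ζ => exp (b * (P.natDegree * P.leadingCoeff * ζ)) * c := by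
      funext ζ
      refine hg.eq_of_tendsto (((hratio ζ).mul hc).congr' (hc0.mono fun n hn => ?_))
      exact div_mul_cancel₀ _ hn
    have hcne : c ≠ 0 := by
      rintro rfl
      exact hne 0 (by simp [hgc])
    have hbne : b ≠ 0 := by
      rintro rfl
      exact hne c (by simp [hgc])
    obtain ⟨e, he1, he⟩ := l.exists_tendsto_div_norm hw
    refine ⟨e, log c, P.natDegree * ‖b‖, he1, ?_, by positivity, ?_⟩
    · have h1 := hR.tendsto_log_mul_exp_div hP hw he
      have h2 := (hc.norm.log (norm_ne_zero_iff.mpr hcne)).div_atTop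
        ((tendsto_pow_atTop (α := ℝ) (n := P.natDegree) (by omega)).comp hw)
      exact tendsto_nhds_unique h1 h2
    · have h3 : b = ‖b‖ * e ^ (P.natDegree - 1) := by
        refine tendsto_nhds_unique hb (((Complex.continuous_ofReal.continuousAt.tendsto.comp
          hb.norm).mul (he.pow (P.natDegree - 1))).congr' ?_)
        filter_upwards [hw.eventually_gt_atTop 0] with n hn
        have : (‖w n‖ : ℂ) ^ (P.natDegree - 1) ≠ 0 := pow_ne_zero _ (by exact_mod_cast hn.ne')
        rw [Function.comp_apply, norm_mul, norm_pow, Complex.norm_real,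
          Real.norm_of_nonneg (hr n).le, div_pow]
        push_cast
        field_simp
      rw [hgc]
      funext ζ
      rw [exp_add, exp_log hcne]
      congr 2
      conv_lhs => rw [h3]
      push_cast
      ring
  · refine absurd (funext fun ζ => ?_) (hne 0)
    refine hg.eq_zero_of_norm_tendsto_atTop ?_
    refine (hinf.atTop_mul_pos (norm_pos_iff.mpr (exp_ne_zero _)) (hratio ζ).norm).congr'
      (hc0.mono fun n hn => ?_)
    rw [← norm_mul, mul_div_cancel₀ _ hn]

/-- Every nonconstant limit of rescalings of `R * exp P` is a rescaling of `R * exp P` or an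
exponential. -/
lemma SphPointwiseConv.classification (hR : IsMonicRational R d) (hP : 1 ≤ P.natDegree)
    (hg : SphPointwiseConv
      (fun n ζ => R (w n + r n * ζ) * exp (P.eval (w n + r n * ζ))) l g)
    (hne : ∀ c : ℂ, g ≠ fun _ => c) (hr : ∀ n, 0 < r n) :
    (∃ (C₁ : ℂ) (C₂ : ℝ), 0 < C₂ ∧
      g = fun ζ => R (C₁ + C₂ * ζ) * exp (P.eval (C₁ + C₂ * ζ))) ∨
    ∃ (e A₀ : ℂ) (t : ℝ), ‖e‖ = 1 ∧ (P.leadingCoeff * e ^ P.natDegree).re = 0 ∧ 0 < t ∧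
      g = fun ζ => exp (t * (P.leadingCoeff * e ^ (P.natDegree - 1)) * ζ + A₀) := by
  have hr0 : ∀ n, (r n : ℂ) ≠ 0 := fun n => by exact_mod_cast (hr n).ne'
  have small : Tendsto (fun n => ‖w n‖) l atTop → Tendsto (fun n => (r n : ℂ) / w n) l (𝓝 0) →
      ∃ (e A₀ : ℂ) (t : ℝ), ‖e‖ = 1 ∧ (P.leadingCoeff * e ^ P.natDegree).re = 0 ∧ 0 < t ∧
      g = fun ζ => exp (t * (P.leadingCoeff * e ^ (P.natDegree - 1)) * ζ + A₀) := by
    intro hw hrw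
    rcases l.tendsto_nhds_or_norm_atTop fun n => w n ^ (P.natDegree - 1) * r n with ⟨b, hb⟩ | hb
    · exact hg.exponential_of_bounded_variation hR hP hne hr hw hrw hb
    · exact absurd (funext (hg.eq_zero_of_unbounded_variation hR hP hr hw hrw hb)) (hne 0)
  rcases l.tendsto_nhds_or_norm_atTop r with ⟨ρ, hρ⟩ | hrinf
  · have hρC : Tendsto (fun n => (r n : ℂ)) l (𝓝 ρ) :=
      Complex.continuous_ofReal.continuousAt.tendsto.comp hρ
    rcases l.tendsto_nhds_or_norm_atTop w with ⟨c, hc⟩ | hw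
    · left
      have hgf : g = fun ζ => R (c + ρ * ζ) * exp (P.eval (c + ρ * ζ)) := funext fun ζ =>
        hg.eq_of_argument_tendsto hR (hc.add (hρC.mul_const ζ))
      refine ⟨c, ρ, lt_of_le_of_ne (ge_of_tendsto' hρ fun n => (hr n).le) ?_, hgf⟩
      rintro rfl
      exact hne (R c * exp (P.eval c)) (by simp [hgf])
    · refine Or.inr (small hw ?_)
      rw [tendsto_zero_iff_norm_tendsto_zero]
      simpa using hρ.norm.div_atTop hw
  · have hrinf' : Tendsto r l atTop := hrinf.congr fun n => Real.norm_of_nonneg (hr n).le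
    rcases l.tendsto_nhds_or_norm_atTop fun n => w n / r n with ⟨q, hq⟩ | hq
    · exact (hg.false_of_large_scale hR hP hrinf' hq).elim
    · refine Or.inr (small ?_ ?_)
      · refine (hq.atTop_mul_atTop₀ hrinf).congr fun n => ?_
        have := (hr n).ne'
        simp [this]
      · rw [tendsto_zero_iff_norm_tendsto_zero]
        refine (tendsto_inv_atTop_zero.comp hq).congr fun n => ?_
        simp

end Limits
section Construction

variable {R : ℂ → ℂ} {d : ℤ} {P : Polynomial ℂ}

lemma exists_root_near (Q : Polynomial ℂ) (hQ : 1 ≤ Q.natDegree) (v : ℂ) :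
    ∃ x, Q.eval x = 0 ∧ ‖Q.leadingCoeff‖ * ‖v - x‖ ^ Q.natDegree ≤ ‖Q.eval v‖ := by
  have hsplit := IsAlgClosed.splits Q
  have hcard : Q.natDegree = Q.roots.card := hsplit.natDegree_eq_card_roots
  have hne : Q.roots ≠ 0 := by
    intro h
    simp [h] at hcard
    omega
  obtain ⟨x, hx, hmin⟩ := Q.roots.toFinset.exists_min_image (fun x => ‖v - x‖)
    (Multiset.toFinset_nonempty.mpr hne)
  rw [Multiset.mem_toFinset] at hx
  refine ⟨x, (Polynomial.mem_roots'.mp hx).2, ?_⟩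
  have hprod : ∀ s : Multiset ℂ, (∀ y ∈ s, ‖v - x‖ ≤ ‖v - y‖) →
      ‖v - x‖ ^ s.card ≤ ‖(s.map fun y => v - y).prod‖ := by
    intro s
    induction s using Multiset.induction_on with
    | empty => simp
    | cons y s ih =>
      intro h
      rw [Multiset.card_cons, Multiset.map_cons, Multiset.prod_cons, norm_mul, pow_succ, mul_comm]
      exact mul_le_mul (h y (by simp)) (ih fun y hy => h y (by simp [hy])) (by positivity)
        (norm_nonneg _)
  have heval : Q.eval v = Q.leadingCoeff * (Q.roots.map fun y => v - y).prod :=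
    hsplit.eval_eq_prod_roots v
  rw [heval, norm_mul, hcard]
  exact mul_le_mul_of_nonneg_left
    (hprod _ fun y hy => hmin y (Multiset.mem_toFinset.mpr hy)) (norm_nonneg _)

/-- Along a direction in which the leading term of `P` is purely imaginary, `R * exp P` comes
arbitrarily close to any prescribed nonzero value. -/
lemma IsMonicRational.exists_tendsto_exp (hR : IsMonicRational R d) (hP : 1 ≤ P.natDegree)
    {φ s : ℝ} (hs : s = 1 ∨ s = -1)
    (he : P.leadingCoeff * exp (φ * I) ^ P.natDegree = ‖P.leadingCoeff‖ * (s * I)) (A₀ : ℂ) :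
    ∃ (τ : ℕ → ℝ) (x : ℕ → ℂ), (∀ n, 0 < τ n) ∧ Tendsto τ atTop atTop ∧
      Tendsto (fun n => x n / (τ n * exp (φ * I))) atTop (𝓝 1) ∧
      Tendsto (fun n => R (x n) * exp (P.eval (x n))) atTop (𝓝 (exp A₀)) := by
  have hk0 : P.natDegree ≠ 0 := by omega
  have ha : P.leadingCoeff ≠ 0 := by
    rw [Polynomial.leadingCoeff_ne_zero]; rintro rfl; simp at hP
  have ha' : 0 < ‖P.leadingCoeff‖ := norm_pos_iff.mpr ha
  set a := P.leadingCoeff with ha_def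
  set k := P.natDegree with hk_def
  have hτ : ∀ n : ℕ, ∃ τ : ℝ, 0 < τ ∧ τ ^ k = 2 * Real.pi * (n + 1) / ‖a‖ := by
    intro n
    have hpos : 0 < 2 * Real.pi * (n + 1) / ‖a‖ := by positivity
    exact ⟨_, Real.rpow_pos_of_pos hpos (k : ℝ)⁻¹, Real.rpow_inv_natCast_pow hpos.le hk0⟩
  choose τ hτ0 hτk using hτ
  have hτpow : Tendsto (fun n => τ n ^ k) atTop atTop := by
    simp only [hτk]
    refine Tendsto.atTop_div_const ha' (Tendsto.const_mul_atTop (by positivity) ?_)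
    exact tendsto_atTop_add_const_right _ _ tendsto_natCast_atTop_atTop
  have hτinf : Tendsto τ atTop atTop := by
    refine tendsto_atTop.mpr fun M => ?_
    filter_upwards [hτpow.eventually_gt_atTop (|M| ^ k)] with n hn
    exact (le_abs_self M).trans (lt_of_pow_lt_pow_left₀ k (hτ0 n).le hn).le
  set v : ℕ → ℂ := fun n => τ n * exp (φ * I) with hv
  have hvnorm : ∀ n, ‖v n‖ = τ n := by
    intro n
    simp [hv, Complex.norm_exp, abs_of_pos (hτ0 n)]
  have hv0 : ∀ n, v n ≠ 0 := fun n => norm_pos_iff.mp (by rw [hvnorm]; exact hτ0 n)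
  have hvinf : Tendsto (fun n => ‖v n‖) atTop atTop := by simpa only [hvnorm] using hτinf
  have hvk : ∀ n, a * v n ^ k = 2 * Real.pi * (n + 1) * (s * I) := by
    intro n
    have h1 : ((τ n : ℂ)) ^ k = 2 * Real.pi * (n + 1) / ‖a‖ := by exact_mod_cast hτk n
    have h2 : (‖a‖ : ℂ) ≠ 0 := by exact_mod_cast ha'.ne'
    calc a * v n ^ k = (τ n : ℂ) ^ k * (a * exp (φ * I) ^ k) := by rw [hv, mul_pow]; ring
      _ = _ := by rw [h1, he]; field_simp
  set L : ℕ → ℂ := fun n => Real.log (τ n) + φ * I with hL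
  have hLexp : ∀ n, exp (L n) = v n := by
    intro n
    rw [hL, exp_add, ← Complex.ofReal_exp, Real.exp_log (hτ0 n)]
  set y : ℕ → ℂ := fun n => A₀ + a * v n ^ k - d * L n with hy
  have hyexp : ∀ n, exp (y n) = exp A₀ / v n ^ d := by
    intro n
    have h1 : exp (a * v n ^ k) = 1 := by
      rw [hvk, Complex.exp_eq_one_iff]
      rcases hs with rfl | rfl
      · exact ⟨n + 1, by push_cast; ring⟩
      · exact ⟨-(n + 1), by push_cast; ring⟩
    rw [hy, exp_sub, exp_add, h1, mul_one, Complex.exp_int_mul, hLexp]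
  have hdegQ : ∀ n, (P - Polynomial.C (y n)).natDegree = k := fun n =>
    Polynomial.natDegree_sub_C
  have hleadQ : ∀ n, (P - Polynomial.C (y n)).leadingCoeff = a := by
    intro n
    rw [Polynomial.leadingCoeff, hdegQ, Polynomial.coeff_sub, Polynomial.coeff_C_of_ne_zero hk0,
      sub_zero, ha_def, Polynomial.leadingCoeff]
  have hroot : ∀ n, ∃ x, P.eval x = y n ∧ ‖a‖ * ‖v n - x‖ ^ k ≤ ‖P.eval (v n) - y n‖ := by
    intro n
    obtain ⟨x, hx, hx'⟩ := exists_root_near (P - Polynomial.C (y n)) (by rw [hdegQ]; exact hP) (v n)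
    rw [hdegQ, hleadQ] at hx'
    refine ⟨x, ?_, by simpa using hx'⟩
    simpa [sub_eq_zero] using hx
  choose x hxy hxv using hroot
  have hrem : Tendsto (fun n => (P.eval (v n) - y n) / v n ^ k) atTop (𝓝 0) := by
    have hlog : Tendsto (fun n => (Real.log (τ n) / τ n ^ k : ℝ)) atTop (𝓝 0) := by
      have hid : IsMonicRational (fun z => z) 1 := by
        refine ⟨?_, fun x => Or.inl continuousAt_id⟩
        refine tendsto_const_nhds.congr' ?_
        filter_upwards [Bornology.eventually_ne_cobounded (0 : ℂ)] with z hz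
        simp [hz]
      simpa only [hvnorm] using hid.tendsto_log_div hvinf hP
    have hinv : Tendsto (fun n => (v n ^ k)⁻¹) atTop (𝓝 0) := by
      simpa using tendsto_pow_div_pow_of_norm_atTop hvinf (show 0 < k by omega)
    have hlog' : Tendsto (fun n => (Real.log (τ n) : ℂ) / v n ^ k) atTop (𝓝 0) := by
      rw [tendsto_zero_iff_norm_tendsto_zero]
      refine (hlog.norm.congr fun n => ?_).trans (by simp)
      simp [hvnorm, abs_of_pos (hτ0 n)]
    have h1 := ((tendsto_eval_div_pow hvinf P).sub_const a).sub ((hinv.const_mul A₀).sub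
      ((hlog'.add (hinv.const_mul (φ * I))).const_mul (d : ℂ)))
    simp only [mul_zero, add_zero, ← ha_def, sub_self] at h1
    refine h1.congr fun n => ?_
    have : v n ^ k ≠ 0 := pow_ne_zero _ (hv0 n)
    rw [hy, hL, ← hk_def]
    field_simp
    ring
  have hxv1 : Tendsto (fun n => x n / v n) atTop (𝓝 1) := by
    have h1 : Tendsto (fun n => ‖(v n - x n) / v n‖ ^ k) atTop (𝓝 0) := by
      have h2 := hrem.norm.div_const ‖a‖
      rw [norm_zero, zero_div] at h2
      refine squeeze_zero (fun n => by positivity) (fun n => ?_) h2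
      have hvp : 0 < ‖v n‖ ^ k := pow_pos (norm_pos_iff.mpr (hv0 n)) _
      rw [norm_div, div_pow, norm_div, norm_pow, div_div, div_le_div_iff₀ hvp (by positivity)]
      nlinarith [hxv n]
    have h3 : Tendsto (fun n => (v n - x n) / v n) atTop (𝓝 0) := by
      rw [tendsto_zero_iff_norm_tendsto_zero]
      have h4 := h1.rpow_const (p := (k : ℝ)⁻¹) (Or.inr (by positivity))
      rw [Real.zero_rpow (inv_ne_zero (by exact_mod_cast hk0))] at h4
      exact h4.congr fun n => Real.pow_rpow_inv_natCast (norm_nonneg _) hk0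
    have h5 := h3.const_sub 1
    rw [sub_zero] at h5
    refine h5.congr fun n => ?_
    have := hv0 n
    field_simp
    ring
  refine ⟨τ, x, hτ0, hτinf, hxv1, ?_⟩
  have h1 := (hR.tendsto_ratio hvinf hxv1).mul_const (exp A₀)
  rw [one_mul] at h1
  refine h1.congr fun n => ?_
  rw [hxy, hyexp]
  ring

lemma sphLocUnifConv_of_tendsto_prod {F : ℕ → ℂ → ℂ} {g : ℂ → ℂ} (hg : Continuous g)
    (h : ∀ z, Tendsto (fun q : ℕ × ℂ => F q.1 q.2) (atTop ×ˢ 𝓝 z) (𝓝 (g z))) :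
    SphLocUnifConv F g := by
  have hloc : TendstoLocallyUniformly F g atTop := by
    rw [tendstoLocallyUniformly_iff_filter]
    intro z
    rw [tendstoUniformlyOnFilter_iff_tendsto]
    exact (((hg.tendsto z).comp tendsto_snd).prodMk_nhds (h z)).mono_right (nhds_le_uniformity _)
  intro z
  exact ⟨Metric.closedBall z 1, Metric.closedBall_mem_nhds z one_pos,
    Or.inl (tendstoLocallyUniformly_iff_forall_isCompact.mp hloc _ (isCompact_closedBall z 1))⟩

/-- For `α = 0` the rescaling data in `Π_α` are an arbitrary centre and an arbitrary positive
scale. -/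
lemma mem_piAlpha_zero {h g : ℂ → ℂ} (hg : MeromorphicOn g Set.univ)
    (hne : ∀ c : ℂ, g ≠ fun _ => c) {w : ℕ → ℂ} {r : ℕ → ℝ} (hr : ∀ n, 0 < r n)
    (hconv : SphLocUnifConv (fun n ζ => h (w n + r n * ζ)) g) : g ∈ PiAlpha 0 h := by
  have hK : ∀ n : ℕ, ∃ K : ℕ, (n + 1) * (1 + ‖w n‖ + r n) ≤ (K : ℝ) := fun n => exists_nat_ge _
  choose K hK using hK
  have hKn : ∀ n : ℕ, (n + 1 : ℝ) ≤ K n := fun n => by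
    refine le_trans ?_ (hK n)
    have := hr n
    have := norm_nonneg (w n)
    nlinarith [(Nat.cast_nonneg n : (0 : ℝ) ≤ n)]
  have hKpos : ∀ n, (0 : ℝ) < K n := fun n => lt_of_lt_of_le (by positivity) (hKn n)
  have hKC : ∀ n, (K n : ℂ) ≠ 0 := fun n => by
    have := (hKpos n).ne'
    exact_mod_cast this
  have bound : ∀ n : ℕ, ∀ t : ℝ, t ≤ 1 + ‖w n‖ + r n → t / K n ≤ 1 / ((n : ℝ) + 1) := by
    intro n t ht
    rw [div_le_div_iff₀ (hKpos n) (by positivity)]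
    nlinarith [hK n, (Nat.cast_nonneg n : (0 : ℝ) ≤ n)]
  refine ⟨hg, hne, 0, K, fun n => w n / K n, fun n => r n / K n, ?_, ?_,
    fun n => div_pos (hr n) (hKpos n), ?_, ?_⟩
  · refine tendsto_atTop_mono (fun n => ?_) tendsto_id
    have := hKn n
    exact_mod_cast (by simp only [id]; linarith : ((id n : ℕ) : ℝ) ≤ K n)
  · rw [tendsto_zero_iff_norm_tendsto_zero]
    refine squeeze_zero (fun n => norm_nonneg _) (fun n => ?_)
      tendsto_one_div_add_atTop_nhds_zero_nat
    rw [norm_div, Complex.norm_natCast]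
    exact bound n _ (by linarith [hr n])
  · refine squeeze_zero (fun n => (div_pos (hr n) (hKpos n)).le)
      (fun n => bound n _ (by linarith [norm_nonneg (w n)]))
      tendsto_one_div_add_atTop_nhds_zero_nat
  · convert hconv using 3 with n ζ
    have := hKC n
    push_cast
    rw [neg_zero, Real.rpow_zero, Complex.ofReal_one, one_mul]
    congr 1
    field_simp

lemma IsMonicRational.exponential_mem_piAlpha_zero (hR : IsMonicRational R d)
    (hP : 1 ≤ P.natDegree) {φ s t : ℝ} (hs : s = 1 ∨ s = -1) (ht : 0 < t)
    (he : P.leadingCoeff * exp (φ * I) ^ P.natDegree = ‖P.leadingCoeff‖ * (s * I)) (A₀ : ℂ) :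
    (fun ζ => exp (t * (P.leadingCoeff * exp (φ * I) ^ (P.natDegree - 1)) * ζ + A₀)) ∈
      PiAlpha 0 fun z => R z * exp (P.eval z) := by
  have ha : P.leadingCoeff ≠ 0 := by
    rw [Polynomial.leadingCoeff_ne_zero]; rintro rfl; simp at hP
  have hkC : (P.natDegree : ℂ) ≠ 0 := by exact_mod_cast (by omega : P.natDegree ≠ 0)
  have htC : (t : ℂ) ≠ 0 := by exact_mod_cast ht.ne'
  obtain ⟨τ, x, hτ0, hτ, hxv, hfx⟩ := hR.exists_tendsto_exp hP hs he A₀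
  have hτC : ∀ n, (τ n : ℂ) ≠ 0 := fun n => by exact_mod_cast (hτ0 n).ne'
  set r : ℕ → ℝ := fun n => t / (P.natDegree * τ n ^ (P.natDegree - 1)) with hr_def
  have hr : ∀ n, 0 < r n := fun n => by
    have : (0 : ℝ) < P.natDegree := by exact_mod_cast hP
    have := hτ0 n
    positivity
  have hr0 : ∀ n, (r n : ℂ) ≠ 0 := fun n => by exact_mod_cast (hr n).ne'
  have hvinf : Tendsto (fun n => ‖(τ n * exp (φ * I) : ℂ)‖) atTop atTop := by
    refine hτ.congr fun n => ?_
    simp [Complex.norm_exp, abs_of_pos (hτ0 n)]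
  have hx := tendsto_norm_of_div_tendsto_one hvinf hxv
  have hb : Tendsto (fun n => x n ^ (P.natDegree - 1) * r n) atTop
      (𝓝 (t / P.natDegree * exp (φ * I) ^ (P.natDegree - 1))) := by
    have h1 := (hxv.pow (P.natDegree - 1)).mul_const
      (t / P.natDegree * exp (φ * I) ^ (P.natDegree - 1))
    rw [one_pow, one_mul] at h1
    refine h1.congr fun n => ?_
    have h2 : (τ n : ℂ) ^ (P.natDegree - 1) ≠ 0 := pow_ne_zero _ (hτC n)
    have h3 : exp (φ * I) ^ (P.natDegree - 1) ≠ 0 := pow_ne_zero _ (exp_ne_zero _)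
    rw [hr_def, div_pow, mul_pow]
    push_cast
    field_simp
  have hrw : Tendsto (fun n => (r n : ℂ) / x n) atTop (𝓝 0) := by
    have h1 : Tendsto (fun n => (x n ^ P.natDegree)⁻¹) atTop (𝓝 0) := by
      simpa using tendsto_pow_div_pow_of_norm_atTop hx (show 0 < P.natDegree by omega)
    have h2 := hb.mul h1
    rw [mul_zero] at h2
    refine h2.congr' ?_
    filter_upwards [hx.eventually_gt_atTop 0] with n hn
    have hxn : x n ≠ 0 := norm_pos_iff.mp hn
    have h3 : x n ^ P.natDegree = x n ^ (P.natDegree - 1) * x n := by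
      rw [← pow_succ, Nat.sub_add_cancel hP]
    have h4 : x n ^ (P.natDegree - 1) ≠ 0 := pow_ne_zero _ hxn
    rw [h3]
    field_simp
  set A₁ := t * (P.leadingCoeff * exp (φ * I) ^ (P.natDegree - 1)) with hA₁
  have hA₁0 : A₁ ≠ 0 := mul_ne_zero htC (mul_ne_zero ha (pow_ne_zero _ (exp_ne_zero _)))
  have hdiff : Differentiable ℂ fun ζ => exp (A₁ * ζ + A₀) := by fun_prop
  refine mem_piAlpha_zero (fun z _ => (hdiff.analyticAt z).meromorphicAt) ?_ hr
    (w := x) (sphLocUnifConv_of_tendsto_prod hdiff.continuous fun z => ?_)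
  · intro c hc
    have h0 := congrFun hc 0
    have h1 := congrFun hc (1 / A₁)
    rw [← h0, exp_add, exp_add, mul_one_div_cancel hA₁0, mul_zero, exp_zero] at h1
    have h2 := mul_right_cancel₀ (exp_ne_zero A₀) h1
    have h3 : ‖exp 1‖ = 1 := by rw [h2, norm_one]
    rw [Complex.norm_exp, Complex.one_re] at h3
    exact absurd h3 (Real.one_lt_exp_iff.mpr one_pos).ne'
  · have hfst : Tendsto (Prod.fst : ℕ × ℂ → ℕ) (atTop ×ˢ 𝓝 z) atTop := tendsto_fst
    have h1 := (hR.tendsto_rescale hP (l := atTop ×ˢ 𝓝 z) (w := fun q : ℕ × ℂ => x q.1)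
      (r := fun q => (r q.1 : ℂ)) (ζ := fun q => q.2) (hx.comp hfst) (fun q => hr0 q.1)
      (hrw.comp hfst) tendsto_snd (hb.comp hfst)).mul (hfx.comp hfst)
    have h2 : exp (t / P.natDegree * exp (φ * I) ^ (P.natDegree - 1) *
        (P.natDegree * P.leadingCoeff * z)) * exp A₀ = exp (A₁ * z + A₀) := by
      rw [exp_add, hA₁]
      congr 2
      field_simp
    rw [h2] at h1
    refine h1.congr' ?_
    filter_upwards [hfst.eventually (hR.eventually_ne_zero hx)] with q hq
    exact div_mul_cancel₀ _ (mul_ne_zero hq (exp_ne_zero _))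

end Construction
section Angles

lemma argument_identity (θ s : ℝ) (j : ℕ) {k : ℕ} (hk : 1 ≤ k) :
    θ + ((k - 1 : ℕ) : ℝ) * ((s * (Real.pi / 2) - θ + 2 * Real.pi * j) / k) =
      (s * (Real.pi / 2) * (k - 1) + θ + (k - 1) * (2 * Real.pi) * j) / k := by
  have : (k : ℝ) ≠ 0 := by exact_mod_cast (by omega : k ≠ 0)
  rw [Nat.cast_sub hk]
  push_cast
  field_simp
  ring

lemma mul_exp_pow_pred {a : ℂ} {θ : ℝ} (ha : a = ‖a‖ * exp (θ * I)) (s : ℝ) (j : ℕ) {k : ℕ}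
    (hk : 1 ≤ k) :
    a * exp (((s * (Real.pi / 2) - θ + 2 * Real.pi * j) / k : ℝ) * I) ^ (k - 1) =
      ‖a‖ * exp (((s * (Real.pi / 2) * (k - 1) + θ + (k - 1) * (2 * Real.pi) * j) / k : ℝ) * I) := by
  rw [← argument_identity θ s j hk, ← Complex.exp_nat_mul]
  conv_lhs => rw [ha]
  rw [mul_assoc, ← exp_add]
  congr 2
  push_cast
  ring

lemma exp_sign_mul_pi_div_two {s : ℝ} (hs : s = 1 ∨ s = -1) :
    exp ((s * (Real.pi / 2) : ℝ) * I) = s * I := by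
  rcases hs with rfl | rfl
  · simp
  · simp [neg_mul, Complex.exp_neg]

lemma mul_exp_pow {a : ℂ} {θ : ℝ} (ha : a = ‖a‖ * exp (θ * I)) {s : ℝ} (hs : s = 1 ∨ s = -1)
    (j : ℕ) {k : ℕ} (hk : 1 ≤ k) :
    a * exp (((s * (Real.pi / 2) - θ + 2 * Real.pi * j) / k : ℝ) * I) ^ k = ‖a‖ * (s * I) := by
  have hk0 : (k : ℂ) ≠ 0 := by exact_mod_cast (by omega : k ≠ 0)
  rw [← Complex.exp_nat_mul, ← exp_sign_mul_pi_div_two hs]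
  conv_lhs => rw [ha]
  rw [mul_assoc, ← exp_add]
  congr 1
  rw [← mul_one (exp ((s * (Real.pi / 2) : ℝ) * I)), ← Complex.exp_nat_mul_two_pi_mul_I j,
    ← exp_add]
  congr 1
  push_cast
  field_simp
  ring

/-- The unit vectors `e` for which `a * e ^ k` is purely imaginary. -/
lemma exists_angle_of_re_eq_zero {a e : ℂ} {θ : ℝ} (ha : a = ‖a‖ * exp (θ * I)) (ha0 : a ≠ 0)
    {k : ℕ} (hk : 1 ≤ k) (he : ‖e‖ = 1) (hre : (a * e ^ k).re = 0) :
    ∃ (s : ℝ) (j : ℕ), (s = 1 ∨ s = -1) ∧ j < k ∧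
      e = exp (((s * (Real.pi / 2) - θ + 2 * Real.pi * j) / k : ℝ) * I) := by
  have hk0 : (k : ℂ) ≠ 0 := by exact_mod_cast (by omega : k ≠ 0)
  have ha' : 0 < ‖a‖ := norm_pos_iff.mpr ha0
  set y := exp (θ * I) * e ^ k with hy
  have hy1 : ‖y‖ = 1 := by simp [hy, Complex.norm_exp, he]
  have hyre : y.re = 0 := by
    rw [ha, mul_assoc, Complex.re_ofReal_mul] at hre
    exact (mul_eq_zero.mp hre).resolve_left ha'.ne'
  obtain ⟨s, hs, hys⟩ : ∃ s : ℝ, (s = 1 ∨ s = -1) ∧ y = s * I := by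
    refine ⟨y.im, ?_, Complex.ext (by simp [hyre]) (by simp)⟩
    have h1 : y.im * y.im = 1 := by
      have := Complex.sq_norm y
      rw [Complex.normSq_apply, hyre, hy1] at this
      linarith
    exact mul_self_eq_one_iff.mp h1
  set e₀ := exp (((s * (Real.pi / 2) - θ) / k : ℝ) * I) with he₀
  have he₀k : e₀ ^ k = e ^ k := by
    refine mul_left_cancel₀ (exp_ne_zero (θ * I)) ?_
    rw [← hy, hys, ← exp_sign_mul_pi_div_two hs, he₀, ← Complex.exp_nat_mul, ← exp_add]
    congr 1
    push_cast
    field_simp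
    ring
  have hroot : (e / e₀) ^ k = 1 := by
    rw [div_pow, he₀k, div_self]
    exact pow_ne_zero _ (norm_ne_zero_iff.mp (by rw [he]; exact one_ne_zero))
  have : NeZero k := ⟨by omega⟩
  obtain ⟨j, hj, hje⟩ := (Complex.isPrimitiveRoot_exp k (by omega)).eq_pow_of_pow_eq_one hroot
  refine ⟨s, j, hs, hj, ?_⟩
  rw [eq_div_iff (exp_ne_zero _), ← Complex.exp_nat_mul, ← exp_add] at hje
  rw [← hje]
  congr 1
  push_cast
  field_simp
  ring

end Angles

section Concrete

lemma isMonicRational_prod_div_prod {m p : ℕ} (γ : Fin m → ℂ) (β : Fin p → ℂ)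
    (hγβ : ∀ i j, γ i ≠ β j) (lm : Fin m → ℕ) (jp : Fin p → ℕ) (hjp : ∀ j, 1 ≤ jp j) :
    IsMonicRational (fun z => (∏ i, (z - γ i) ^ lm i) / ∏ j, (z - β j) ^ jp j)
      ((∑ i, lm i : ℕ) - (∑ j, jp j : ℕ)) := by
  constructor
  · have hfac : ∀ c : ℂ, Tendsto (fun x => (x - c) / x) (Bornology.cobounded ℂ) (𝓝 1) := by
      intro c
      have h1 := (tendsto_inv₀_cobounded (α := ℂ)).const_mul c |>.const_sub 1
      rw [mul_zero, sub_zero] at h1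
      refine h1.congr' ?_
      filter_upwards [Bornology.eventually_ne_cobounded (0 : ℂ)] with x hx
      field_simp
    have hprod : ∀ {q : ℕ} (c : Fin q → ℂ) (n : Fin q → ℕ),
        Tendsto (fun x => ∏ i, ((x - c i) / x) ^ n i) (Bornology.cobounded ℂ) (𝓝 1) := by
      intro q c n
      simpa using tendsto_finsetProd Finset.univ fun i _ => (hfac (c i)).pow (n i)
    have h1 := (hprod γ lm).div (hprod β jp) one_ne_zero
    rw [div_one] at h1
    refine h1.congr' ?_
    filter_upwards [Bornology.eventually_ne_cobounded (0 : ℂ)] with x hx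
    have h2 : x ^ (∑ i, lm i) ≠ 0 := pow_ne_zero _ hx
    have h3 : x ^ (∑ j, jp j) ≠ 0 := pow_ne_zero _ hx
    simp only [Pi.div_apply, div_pow, Finset.prod_div_distrib, Finset.prod_pow_eq_pow_sum]
    rw [zpow_sub₀ hx, zpow_natCast, zpow_natCast]
    field_simp
  · intro x
    have hnum : Continuous fun z => ∏ i, (z - γ i) ^ lm i := by fun_prop
    have hden : Continuous fun z => ∏ j, (z - β j) ^ jp j := by fun_prop
    by_cases hx : ∃ j, x = β j
    · right
      obtain ⟨j, rfl⟩ := hx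
      have hden0 : ∏ i, (β j - β i) ^ jp i = 0 :=
        Finset.prod_eq_zero (Finset.mem_univ j) (by simp [show jp j ≠ 0 by have := hjp j; omega])
      have hnum0 : ∏ i, (β j - γ i) ^ lm i ≠ 0 :=
        Finset.prod_ne_zero_iff.mpr fun i _ => pow_ne_zero _ (sub_ne_zero.mpr (hγβ i j).symm)
      refine ⟨by simp only [hden0, div_zero], ?_⟩
      have hev : ∀ᶠ y in 𝓝[≠] (β j), ∏ i, (y - β i) ^ jp i ≠ 0 := by
        have : ∀ᶠ y in 𝓝[≠] (β j), ∀ i, y ≠ β i := by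
          rw [Filter.eventually_all]
          intro i
          by_cases hij : β j = β i
          · rw [← hij]; exact self_mem_nhdsWithin
          · exact (eventually_ne_nhds hij).filter_mono nhdsWithin_le_nhds
        filter_upwards [this] with y hy
        exact Finset.prod_ne_zero_iff.mpr fun i _ => pow_ne_zero _ (sub_ne_zero.mpr (hy i))
      have h1 : Tendsto (fun y => ‖∏ i, (y - β i) ^ jp i‖) (𝓝[≠] (β j)) (𝓝[>] 0) := by
        rw [tendsto_nhdsWithin_iff]
        refine ⟨?_, hev.mono fun y hy => norm_pos_iff.mpr hy⟩
        have := (hden.norm.tendsto (β j)).mono_left (nhdsWithin_le_nhds (s := {β j}ᶜ))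
        rwa [hden0, norm_zero] at this
      have h2 := (hnum.norm.tendsto (β j)).mono_left (nhdsWithin_le_nhds (s := {β j}ᶜ))
      refine (h2.pos_mul_atTop (norm_pos_iff.mpr hnum0) (tendsto_inv_nhdsGT_zero.comp h1)).congr
        fun y => ?_
      rw [norm_div, div_eq_mul_inv, Function.comp_apply]
    · left
      push Not at hx
      exact hnum.continuousAt.div hden.continuousAt
        (Finset.prod_ne_zero_iff.mpr fun i _ => pow_ne_zero _ (sub_ne_zero.mpr (hx i)))

lemma IsMonicRational.comp_affine_ne_const {R : ℂ → ℂ} {d : ℤ} (hR : IsMonicRational R d)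
    {P : Polynomial ℂ} (hP : 1 ≤ P.natDegree) (C₁ : ℂ) {C₂ : ℝ} (hC₂ : 0 < C₂) (c : ℂ) :
    (fun ζ => R (C₁ + C₂ * ζ) * exp (P.eval (C₁ + C₂ * ζ))) ≠ fun _ => c := by
  intro h
  have hC : (C₂ : ℂ) ≠ 0 := by exact_mod_cast hC₂.ne'
  have hconst : ∀ x, R x * exp (P.eval x) = c := by
    intro x
    have := congrFun h ((x - C₁) / C₂)
    simpa only [mul_div_cancel₀ _ hC, add_sub_cancel] using this
  obtain ⟨u, hu0, hu⟩ := exists_direction hP one_ne_zero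
  have hx : Tendsto (fun n : ℕ => ‖(n : ℂ) * u‖) atTop atTop := by
    simp only [norm_mul, Complex.norm_natCast]
    exact tendsto_natCast_atTop_atTop.atTop_mul_const (norm_pos_iff.mpr hu0)
  have hdir : Tendsto (fun n : ℕ => (n : ℂ) * u / ‖(n : ℂ) * u‖) atTop (𝓝 (u / ‖u‖)) := by
    refine tendsto_const_nhds.congr' ?_
    filter_upwards [eventually_gt_atTop 0] with n hn
    have : (n : ℂ) ≠ 0 := by exact_mod_cast hn.ne'
    rw [norm_mul, Complex.norm_natCast]
    push_cast
    rw [mul_div_mul_left _ _ this]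
  have hinf := hR.norm_tendsto_atTop hP hx hdir (by rw [hu]; positivity)
  simp only [hconst] at hinf
  exact not_tendsto_of_norm_tendsto_atTop hinf tendsto_const_nhds

lemma meromorphicOn_comp_affine {m p : ℕ} (γ : Fin m → ℂ) (β : Fin p → ℂ) (lm : Fin m → ℕ)
    (jp : Fin p → ℕ) (P : Polynomial ℂ) (C₁ C₂ : ℂ) :
    MeromorphicOn (fun ζ => (∏ i, (C₁ + C₂ * ζ - γ i) ^ lm i) / (∏ j, (C₁ + C₂ * ζ - β j) ^ jp j) *
      exp (P.eval (C₁ + C₂ * ζ))) Set.univ := by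
  intro z _
  have h1 : Differentiable ℂ fun ζ => ∏ i, (C₁ + C₂ * ζ - γ i) ^ lm i := by fun_prop
  have h2 : Differentiable ℂ fun ζ => ∏ j, (C₁ + C₂ * ζ - β j) ^ jp j := by fun_prop
  have h3 : Differentiable ℂ fun ζ => exp (P.eval (C₁ + C₂ * ζ)) :=
    (P.differentiable.comp (by fun_prop : Differentiable ℂ fun ζ => C₁ + C₂ * ζ)).cexp
  exact ((h1.analyticAt z).meromorphicAt.div (h2.analyticAt z).meromorphicAt).mul
    (h3.analyticAt z).meromorphicAt

end Concrete

/-- (Theorem 1, case `k ≥ 2`, `α = 0`) For `f = R·e^P` with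
`deg P = k ≥ 2`, leading coefficient `a_k` of argument `θa ∈ [0, 2π)`:
`Π_0(f) = { ζ ↦ f(C₁ + C₂ζ) : C₁ ∈ ℂ, C₂ > 0 } ∪ { ζ ↦ e^{A₁ζ + A₀} : A₀ ∈ ℂ,
arg A₁ = (±(π/2)(k−1) + θa + (k−1)·2πl)/k (mod 2π), l = 0,…,k−1 }`. -/
theorem piAlpha_zero_higher
    (m p : ℕ) (γ : Fin m → ℂ) (β : Fin p → ℂ)
    (hγ : Function.Injective γ) (hβ : Function.Injective β) (hγβ : ∀ i j, γ i ≠ β j)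
    (lm : Fin m → ℕ) (hlm : ∀ i, 1 ≤ lm i) (jp : Fin p → ℕ) (hjp : ∀ j, 1 ≤ jp j)
    (R : ℂ → ℂ) (hR : R = fun z => (∏ i, (z - γ i) ^ lm i) / ∏ j, (z - β j) ^ jp j)
    (P : Polynomial ℂ) (k : ℕ) (hk : 2 ≤ k) (hdeg : P.natDegree = k)
    (ak : ℂ) (hak : P.leadingCoeff = ak)
    (θa : ℝ) (hθ₁ : 0 ≤ θa) (hθ₂ : θa < 2 * Real.pi)
    (hθ : ak = (‖ak‖ : ℂ) * Complex.exp (θa * Complex.I))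
    (f : ℂ → ℂ) (hf : f = fun z => R z * Complex.exp (P.eval z)) :
    PiAlpha 0 f =
      { g | (∃ (C₁ : ℂ) (C₂ : ℝ), 0 < C₂ ∧ g = fun ζ => f (C₁ + (C₂ : ℂ) * ζ)) ∨
            (∃ A₀ A₁ : ℂ,
              (∃ (s : ℝ) (l : ℕ) (t : ℝ), (s = 1 ∨ s = -1) ∧ l < k ∧ 0 < t ∧
                A₁ = (t : ℂ) * Complex.exp
                  (((s * (Real.pi / 2) * (k - 1) + θa + (k - 1) * (2 * Real.pi) * l) / k : ℝ)
                    * Complex.I)) ∧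
              g = fun ζ => Complex.exp (A₁ * ζ + A₀)) } := by
  have hP : 1 ≤ P.natDegree := by omega
  have ha0 : P.leadingCoeff ≠ 0 := by
    rw [Polynomial.leadingCoeff_ne_zero]; rintro rfl; simp at hP
  subst hak hdeg hf
  have hRat := hR ▸ isMonicRational_prod_div_prod γ β hγβ lm jp hjp
  ext g
  constructor
  · rintro ⟨-, hne, z₀, K, z, ρ, hK, -, hρ, -, hconv⟩
    let r : ℕ → ℝ := fun n => if 1 ≤ K n then K n * ρ n else 1
    have hr : ∀ n, 0 < r n := by
      intro n
      by_cases h : 1 ≤ K n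
      · have h1 : (0 : ℝ) < K n := by exact_mod_cast h
        simpa only [r, if_pos h] using mul_pos h1 (hρ n)
      · simp only [r, if_neg h, one_pos]
    have hpw : SphPointwiseConv (fun n ζ => R ((K n * z n : ℂ) + r n * ζ) *
        exp (P.eval ((K n * z n : ℂ) + r n * ζ))) (hyperfilter ℕ) g := by
      have hle : (hyperfilter ℕ : Filter ℕ) ≤ atTop := Nat.hyperfilter_le_atTop
      refine (hconv.pointwise hle).congr' ?_
      filter_upwards [(hK.eventually_ge_atTop 1).filter_mono hle] with n hn
      funext ζ
      simp only [r, if_pos hn, neg_zero, Real.rpow_zero, Complex.ofReal_one, one_mul,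
        Complex.ofReal_mul, Complex.ofReal_natCast]
    rcases hpw.classification hRat hP hne hr with h | ⟨e, A₀, t, he, hre, ht, hg⟩
    · exact Or.inl h
    · obtain ⟨s, j, hs, hj, rfl⟩ := exists_angle_of_re_eq_zero hθ ha0 hP he hre
      refine Or.inr ⟨A₀, _, ⟨s, j, t * ‖P.leadingCoeff‖, hs, hj,
        mul_pos ht (norm_pos_iff.mpr ha0), rfl⟩, ?_⟩
      rw [hg, mul_exp_pow_pred hθ s j hP]
      push_cast
      simp only [mul_assoc]
  · rintro (⟨C₁, C₂, hC₂, rfl⟩ | ⟨A₀, A₁, ⟨s, j, t, hs, hj, ht, rfl⟩, rfl⟩)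
    · refine mem_piAlpha_zero ?_ (hRat.comp_affine_ne_const hP C₁ hC₂) (w := fun _ => C₁)
        (r := fun _ => C₂) (fun _ => hC₂) fun z => ⟨Set.univ, univ_mem, Or.inl ?_⟩
      · simpa only [hR] using meromorphicOn_comp_affine γ β lm jp P C₁ C₂
      · exact fun u hu => Eventually.of_forall fun _ _ _ => refl_mem_uniformity hu
    · have h := hRat.exponential_mem_piAlpha_zero hP hs
        (div_pos ht (norm_pos_iff.mpr ha0)) (mul_exp_pow hθ hs j hP) A₀
      rw [mul_exp_pow_pred hθ s j hP] at h
      have hn : (‖P.leadingCoeff‖ : ℂ) ≠ 0 := by exact_mod_cast (norm_pos_iff.mpr ha0).ne'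
      rwa [← mul_assoc, Complex.ofReal_div, div_mul_cancel₀ _ hn] at h
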